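/- arXiv:2505.14851 — 2 statements merged into one kernel-verified Lean document; each statement's English description precedes it below -/
import Mathlib

section
/- Proposition 1: Let c(z,z') = exp(−||z−z'||²/σ_c²) for some σ_c² > 0 be the Gaussian kernel on 𝒵 = ℝ^d × 𝒲, and suppose the regression model W = m_W(X) + Σ_W(X)(𝓔_W) holds, where Σ_W(x) : 𝒮 → 𝒲 is a bounded linear operator for every x ∈ ℝ^d, 𝓔_W ∈ 𝒮 is independent of X, 𝒮 is a normed space, and E[||𝓔_W||] < ∞. Assume m_W and Σ_W are continuously Fréchet differentiable in x (the latter with respect to the operator norm) and that there is h₂ > 0 with Σ_{k=1}^d E[ sup_{||x₀|| ≤ h₂} ( ||∂m_W(X+x₀)/∂x^k||² + ||∂Σ_W(X+x₀)/∂x^k||² ) · 1{X+x₀ ∈ supp(P_X)} ] < ∞. Then condition (T3) holds, i.e. for every z' ∈ 𝒵 the function b(x,z') = E[c(Z,z')|X=x] is continuously differentiable in x and Σ_{k=1}^d E[ sup_{||x₀|| ≤ h₂} |∂b(X+x₀,Z)/∂x^k|² · 1{X+x₀ ∈ supp(P_X)} ] < ∞. -/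
/-!
Proposition 1: for the Gaussian kernel `c(z,z') = exp(−‖z−z'‖²/σ_c²)` on
`𝒵 = ℝ^d × 𝒲` and the regression model `W = m_W(X) + Σ_W(X)(𝓔_W)` with `𝓔_W`
independent of `X` and `E‖𝓔_W‖ < ∞`, if `m_W` and `Σ_W` are continuously Fréchet
differentiable and satisfy the moment bound (Pr1.2), then condition (T3) holds for
`b(x,z') = E[c(Z,z')|X=x]`, which (by independence) is given by the explicit formula
`b(x,z') = E[c((x, m_W(x) + Σ_W(x)(𝓔_W)), z')]`.
-/

open MeasureTheory ProbabilityTheory Filter Set Metric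
open scoped ENNReal Classical

noncomputable section

/-- The unnormalised Gaussian `v ↦ exp (-‖v‖² / s)`. -/
def gaussianBump (s : ℝ) {H : Type*} [NormedAddCommGroup H] (v : H) : ℝ :=
  Real.exp (-‖v‖ ^ 2 / s)

section GaussianBump

variable {H : Type*} [NormedAddCommGroup H] {s : ℝ}

lemma gaussianBump_nonneg (v : H) : 0 ≤ gaussianBump s v := (Real.exp_pos _).le

lemma gaussianBump_le_one (hs : 0 < s) (v : H) : gaussianBump s v ≤ 1 := by
  refine Real.exp_le_one_iff.2 ?_
  rw [neg_div]
  have : 0 ≤ ‖v‖ ^ 2 / s := by positivity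
  linarith

variable [InnerProductSpace ℝ H]

lemma contDiff_gaussianBump {n : WithTop ℕ∞} : ContDiff ℝ n (gaussianBump s : H → ℝ) :=
  (((contDiff_norm_sq ℝ).neg).div_const s).exp

lemma norm_fderiv_gaussianBump_le (hs : 0 < s) (v : H) :
    ‖fderiv ℝ (gaussianBump s) v‖ ≤ s⁻¹ + 1 := by
  have hder : HasFDerivAt (gaussianBump s : H → ℝ)
      (gaussianBump s v • (s⁻¹ • -((2 : ℝ) • innerSL ℝ v))) v := by
    have h₁ := (((hasStrictFDerivAt_norm_sq v).hasFDerivAt.neg).const_mul s⁻¹).exp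
    refine (h₁.congr_of_eventuallyEq (Eventually.of_forall fun w => ?_)).congr_fderiv ?_
    · simp [gaussianBump, div_eq_inv_mul]
    · ext w
      simp [gaussianBump, div_eq_inv_mul, two_smul]
  rw [hder.fderiv, norm_smul, norm_smul, norm_neg, norm_smul, innerSL_apply_norm,
    Real.norm_of_nonneg (gaussianBump_nonneg v), Real.norm_of_nonneg (inv_nonneg.2 hs.le),
    Real.norm_of_nonneg zero_le_two]
  set t := ‖v‖ ^ 2 / s with ht
  have hexp : gaussianBump s v * t ≤ 1 := by
    have h₁ : t ≤ Real.exp t := by linarith [Real.add_one_le_exp t]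
    have h₂ : gaussianBump s v = (Real.exp t)⁻¹ := by
      rw [gaussianBump, neg_div, Real.exp_neg]
    rw [h₂, inv_mul_le_iff₀ (Real.exp_pos t), mul_one]
    exact h₁
  have hlin : s⁻¹ * (2 * ‖v‖) ≤ s⁻¹ + t := by
    have h₁ : 2 * ‖v‖ ≤ 1 + ‖v‖ ^ 2 := by nlinarith [sq_nonneg (‖v‖ - 1)]
    calc s⁻¹ * (2 * ‖v‖) ≤ s⁻¹ * (1 + ‖v‖ ^ 2) := by gcongr
      _ = s⁻¹ + t := by rw [ht]; ring
  calc gaussianBump s v * (s⁻¹ * (2 * ‖v‖)) ≤ gaussianBump s v * (s⁻¹ + t) :=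
        mul_le_mul_of_nonneg_left hlin (gaussianBump_nonneg v)
    _ = gaussianBump s v * s⁻¹ + gaussianBump s v * t := by ring
    _ ≤ 1 * s⁻¹ + 1 := add_le_add
        (mul_le_mul_of_nonneg_right (gaussianBump_le_one hs v) (inv_nonneg.2 hs.le)) hexp
    _ = s⁻¹ + 1 := by ring

end GaussianBump

section RegressionKernel

open scoped Topology

variable {E V S : Type*} [NormedAddCommGroup E]
  [NormedAddCommGroup V] [InnerProductSpace ℝ V] [NormedAddCommGroup S] [NormedSpace ℝ S]

/-- The Gaussian kernel between `(x, m x + A x e)` and `(a, w)`. -/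
def regressionKernel (s : ℝ) (m : E → V) (A : E → S →L[ℝ] V) (a : E) (w : V) (x : E) (e : S) : ℝ :=
  gaussianBump s (x - a) * gaussianBump s (m x + A x e - w)

variable {s : ℝ} {m : E → V} {A : E → S →L[ℝ] V} (a : E) (w : V)

lemma abs_regressionKernel_le_one (hs : 0 < s) (x : E) (e : S) :
    |regressionKernel s m A a w x e| ≤ 1 := by
  unfold regressionKernel
  rw [abs_of_nonneg (mul_nonneg (gaussianBump_nonneg _) (gaussianBump_nonneg _))]
  exact mul_le_one₀ (gaussianBump_le_one hs _) (gaussianBump_nonneg _) (gaussianBump_le_one hs _)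

variable [InnerProductSpace ℝ E]

/-- The Fréchet derivative of `regressionKernel` in its variable `x`. -/
def regressionKernelDeriv (s : ℝ) (m : E → V) (A : E → S →L[ℝ] V) (a : E) (w : V) (x : E) (e : S) :
    E →L[ℝ] ℝ :=
  gaussianBump s (x - a) • (fderiv ℝ (gaussianBump s) (m x + A x e - w)).comp
      (fderiv ℝ m x + (fderiv ℝ A x).flip e) +
    gaussianBump s (m x + A x e - w) • fderiv ℝ (gaussianBump s) (x - a)

lemma hasFDerivAt_regressionKernel (hm : ContDiff ℝ 1 m) (hA : ContDiff ℝ 1 A) (x : E) (e : S) :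
    HasFDerivAt (fun y => regressionKernel s m A a w y e)
      (regressionKernelDeriv s m A a w x e) x := by
  have hm' := (hm.differentiable one_ne_zero x).hasFDerivAt
  have hA' := (hA.differentiable one_ne_zero x).hasFDerivAt
  have hAe : HasFDerivAt (fun y => A y e) ((fderiv ℝ A x).flip e) x := by
    simpa using hA'.clm_apply (hasFDerivAt_const e x)
  have h₁ : HasFDerivAt (fun y => gaussianBump s (y - a))
      (fderiv ℝ (gaussianBump s) (x - a)) x := by
    have hg := ((contDiff_gaussianBump (s := s)).differentiable one_ne_zero (x - a)).hasFDerivAt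
    exact hg.comp x ((hasFDerivAt_id x).sub_const a)
  have h₂ := ((contDiff_gaussianBump (s := s)).differentiable one_ne_zero
    (m x + A x e - w)).hasFDerivAt.comp x ((hm'.add hAe).sub_const w)
  exact h₁.mul h₂

lemma continuous_regressionKernel (hm : Continuous m) (hA : Continuous A) :
    Continuous fun p : E × S => regressionKernel s m A a w p.1 p.2 := by
  have hE : Continuous (gaussianBump s : E → ℝ) :=
    (contDiff_gaussianBump (n := 0)).continuous
  have hV : Continuous (gaussianBump s : V → ℝ) :=
    (contDiff_gaussianBump (n := 0)).continuous
  unfold regressionKernel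
  fun_prop

lemma continuous_regressionKernelDeriv (hm : ContDiff ℝ 1 m) (hA : ContDiff ℝ 1 A) :
    Continuous fun p : E × S => regressionKernelDeriv s m A a w p.1 p.2 := by
  have hE : Continuous (gaussianBump s : E → ℝ) :=
    (contDiff_gaussianBump (n := 0)).continuous
  have hV : Continuous (gaussianBump s : V → ℝ) :=
    (contDiff_gaussianBump (n := 0)).continuous
  have hE' : Continuous (fderiv ℝ (gaussianBump s : E → ℝ)) :=
    contDiff_gaussianBump.continuous_fderiv one_ne_zero
  have hV' : Continuous (fderiv ℝ (gaussianBump s : V → ℝ)) :=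
    contDiff_gaussianBump.continuous_fderiv one_ne_zero
  have hmc := hm.continuous
  have hAc := hA.continuous
  have hm' := hm.continuous_fderiv one_ne_zero
  have hA' := hA.continuous_fderiv one_ne_zero
  have hflip : Continuous fun p : E × S => (fderiv ℝ A p.1).flip p.2 := by
    have : Continuous fun p : E × S => (fderiv ℝ A p.1).flip :=
      (ContinuousLinearMap.flipₗᵢ ℝ E S V).continuous.comp (hA'.comp continuous_fst)
    exact this.clm_apply continuous_snd
  have hu : Continuous fun p : E × S => m p.1 + A p.1 p.2 - w := by fun_prop
  unfold regressionKernelDeriv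
  exact ((hE.comp (continuous_fst.sub continuous_const)).smul
    ((hV'.comp hu).clm_comp ((hm'.comp continuous_fst).add hflip))).add
    ((hV.comp hu).smul (hE'.comp (continuous_fst.sub continuous_const)))

lemma abs_regressionKernelDeriv_apply_le (hs : 0 < s) (x : E) (e : S) (h : E) :
    |regressionKernelDeriv s m A a w x e h| ≤
      (s⁻¹ + 1) * (‖h‖ + ‖fderiv ℝ m x h‖ + ‖fderiv ℝ A x h‖ * ‖e‖) := by
  have hC : 0 ≤ s⁻¹ + 1 := by positivity
  have hmul {r q : ℝ} (hr : 0 ≤ r) (hr' : r ≤ 1) : |r * q| ≤ |q| := by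
    rw [abs_mul, abs_of_nonneg hr]
    exact mul_le_of_le_one_left (abs_nonneg q) hr'
  have h₁ : |fderiv ℝ (gaussianBump s) (m x + A x e - w) (fderiv ℝ m x h + fderiv ℝ A x h e)| ≤
      (s⁻¹ + 1) * (‖fderiv ℝ m x h‖ + ‖fderiv ℝ A x h‖ * ‖e‖) :=
    (ContinuousLinearMap.le_of_opNorm_le _ (norm_fderiv_gaussianBump_le hs _) _).trans <|
      mul_le_mul_of_nonneg_left
        ((norm_add_le _ _).trans (by gcongr; exact (fderiv ℝ A x h).le_opNorm e)) hC
  have h₂ : |fderiv ℝ (gaussianBump s) (x - a) h| ≤ (s⁻¹ + 1) * ‖h‖ :=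
    ContinuousLinearMap.le_of_opNorm_le _ (norm_fderiv_gaussianBump_le hs _) _
  calc |regressionKernelDeriv s m A a w x e h|
      ≤ |fderiv ℝ (gaussianBump s) (m x + A x e - w) (fderiv ℝ m x h + fderiv ℝ A x h e)| +
        |fderiv ℝ (gaussianBump s) (x - a) h| :=
        (abs_add_le _ _).trans (add_le_add
          (hmul (gaussianBump_nonneg _) (gaussianBump_le_one hs _))
          (hmul (gaussianBump_nonneg _) (gaussianBump_le_one hs _)))
    _ ≤ _ := add_le_add h₁ h₂
    _ = _ := by ring

lemma norm_regressionKernelDeriv_le (hs : 0 < s) (x : E) (e : S) :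
    ‖regressionKernelDeriv s m A a w x e‖ ≤
      (s⁻¹ + 1) * (1 + ‖fderiv ℝ m x‖ + ‖fderiv ℝ A x‖ * ‖e‖) := by
  have hC : 0 ≤ s⁻¹ + 1 := by positivity
  refine ContinuousLinearMap.opNorm_le_bound _ (by positivity) fun h => ?_
  calc ‖regressionKernelDeriv s m A a w x e h‖
      ≤ (s⁻¹ + 1) * (‖h‖ + ‖fderiv ℝ m x h‖ + ‖fderiv ℝ A x h‖ * ‖e‖) :=
        abs_regressionKernelDeriv_apply_le a w hs x e h
    _ ≤ (s⁻¹ + 1) * (‖h‖ + ‖fderiv ℝ m x‖ * ‖h‖ + ‖fderiv ℝ A x‖ * ‖h‖ * ‖e‖) := by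
        gcongr
        · exact (fderiv ℝ m x).le_opNorm h
        · exact (fderiv ℝ A x).le_opNorm h
    _ = _ := by ring

lemma exists_ball_norm_regressionKernelDeriv_le (hs : 0 < s) (hm : ContDiff ℝ 1 m)
    (hA : ContDiff ℝ 1 A) (x : E) :
    ∃ K : ℝ, ∀ᶠ y in 𝓝 x, ∀ e, ‖regressionKernelDeriv s m A a w y e‖ ≤ K * (1 + ‖e‖) := by
  have hm' := (hm.continuous_fderiv one_ne_zero).norm.continuousAt (x := x)
  have hA' := (hA.continuous_fderiv one_ne_zero).norm.continuousAt (x := x)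
  have hC : 0 ≤ s⁻¹ + 1 := by positivity
  refine ⟨(s⁻¹ + 1) * (1 + (‖fderiv ℝ m x‖ + 1) + (‖fderiv ℝ A x‖ + 1)), ?_⟩
  filter_upwards [hm'.eventually_lt_const (lt_add_one _), hA'.eventually_lt_const (lt_add_one _)]
    with y hy₁ hy₂ e
  refine (norm_regressionKernelDeriv_le a w hs y e).trans ?_
  rw [mul_assoc]
  refine mul_le_mul_of_nonneg_left ?_ hC
  nlinarith [norm_nonneg e, norm_nonneg (fderiv ℝ m x), norm_nonneg (fderiv ℝ A x),
    mul_le_mul_of_nonneg_right hy₂.le (norm_nonneg e),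
    mul_nonneg (norm_nonneg (fderiv ℝ m x)) (norm_nonneg e)]

variable {Ω : Type*} [MeasurableSpace Ω] {μ : Measure Ω}
  [MeasurableSpace S] [BorelSpace S] {ε : Ω → S}

lemma aestronglyMeasurable_regressionKernel (hm : Continuous m) (hA : Continuous A)
    (hε : Measurable ε) (x : E) :
    AEStronglyMeasurable (fun ω => regressionKernel s m A a w x (ε ω)) μ :=
  (((continuous_regressionKernel a w hm hA).comp
    (Continuous.prodMk_right x)).measurable.comp hε).aestronglyMeasurable

variable [FiniteDimensional ℝ E]

lemma aestronglyMeasurable_regressionKernelDeriv (hm : ContDiff ℝ 1 m) (hA : ContDiff ℝ 1 A)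
    (hε : Measurable ε) (x : E) :
    AEStronglyMeasurable (fun ω => regressionKernelDeriv s m A a w x (ε ω)) μ := by
  borelize (E →L[ℝ] ℝ)
  exact (((continuous_regressionKernelDeriv a w hm hA).comp
    (Continuous.prodMk_right x)).measurable.comp hε).aestronglyMeasurable

variable [IsProbabilityMeasure μ]

lemma hasFDerivAt_integral_regressionKernel (hs : 0 < s) (hm : ContDiff ℝ 1 m)
    (hA : ContDiff ℝ 1 A) (hε : Measurable ε) (hint : Integrable (fun ω => ‖ε ω‖) μ) (x : E) :
    HasFDerivAt (fun y => ∫ ω, regressionKernel s m A a w y (ε ω) ∂μ)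
      (∫ ω, regressionKernelDeriv s m A a w x (ε ω) ∂μ) x := by
  obtain ⟨K, hK⟩ := exists_ball_norm_regressionKernelDeriv_le a w hs hm hA x
  refine hasFDerivAt_integral_of_dominated_of_fderiv_le hK
    (Eventually.of_forall fun y =>
      aestronglyMeasurable_regressionKernel a w hm.continuous hA.continuous hε y)
    (Integrable.of_bound
      (aestronglyMeasurable_regressionKernel a w hm.continuous hA.continuous hε x) 1
      (ae_of_all _ fun ω => abs_regressionKernel_le_one a w hs x (ε ω)))
    (aestronglyMeasurable_regressionKernelDeriv a w hm hA hε x)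
    (ae_of_all _ fun ω y hy => hy (ε ω)) (((integrable_const 1).add hint).const_mul K)
    (ae_of_all _ fun ω y _ => hasFDerivAt_regressionKernel a w hm hA y (ε ω))

lemma contDiff_integral_regressionKernel (hs : 0 < s) (hm : ContDiff ℝ 1 m)
    (hA : ContDiff ℝ 1 A) (hε : Measurable ε) (hint : Integrable (fun ω => ‖ε ω‖) μ) :
    ContDiff ℝ 1 fun y => ∫ ω, regressionKernel s m A a w y (ε ω) ∂μ := by
  refine contDiff_one_iff_hasFDerivAt.2
    ⟨_, ?_, hasFDerivAt_integral_regressionKernel a w hs hm hA hε hint⟩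
  refine continuous_iff_continuousAt.2 fun x => ?_
  obtain ⟨K, hK⟩ := exists_ball_norm_regressionKernelDeriv_le a w hs hm hA x
  exact continuousAt_of_dominated
    (Eventually.of_forall fun y => aestronglyMeasurable_regressionKernelDeriv a w hm hA hε y)
    (hK.mono fun y hy => ae_of_all _ fun ω => hy (ε ω))
    (((integrable_const 1).add hint).const_mul K)
    (ae_of_all _ fun ω => ((continuous_regressionKernelDeriv a w hm hA).comp
      (Continuous.prodMk_left (ε ω))).continuousAt)

lemma abs_fderiv_integral_regressionKernel_le (hs : 0 < s) (hm : ContDiff ℝ 1 m)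
    (hA : ContDiff ℝ 1 A) (hε : Measurable ε) (hint : Integrable (fun ω => ‖ε ω‖) μ) (x h : E) :
    |fderiv ℝ (fun y => ∫ ω, regressionKernel s m A a w y (ε ω) ∂μ) x h| ≤
      (s⁻¹ + 1) * (‖h‖ + ‖fderiv ℝ m x h‖ + ‖fderiv ℝ A x h‖ * ∫ ω, ‖ε ω‖ ∂μ) := by
  have hC : 0 ≤ s⁻¹ + 1 := by positivity
  have hbound : Integrable
      (fun ω => (s⁻¹ + 1) * (‖h‖ + ‖fderiv ℝ m x h‖ + ‖fderiv ℝ A x h‖ * ‖ε ω‖)) μ :=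
    ((integrable_const _).add (hint.const_mul _)).const_mul _
  have hD : Integrable (fun ω => regressionKernelDeriv s m A a w x (ε ω)) μ := by
    refine Integrable.mono' (g := fun ω => (s⁻¹ + 1) *
      (1 + ‖fderiv ℝ m x‖ + ‖fderiv ℝ A x‖ * ‖ε ω‖))
      (((integrable_const _).add (hint.const_mul _)).const_mul _)
      (aestronglyMeasurable_regressionKernelDeriv a w hm hA hε x)
      (ae_of_all _ fun ω => norm_regressionKernelDeriv_le a w hs x (ε ω))
  rw [(hasFDerivAt_integral_regressionKernel a w hs hm hA hε hint x).fderiv,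
    ContinuousLinearMap.integral_apply hD]
  refine (norm_integral_le_of_norm_le (f := fun ω => regressionKernelDeriv s m A a w x (ε ω) h)
    hbound (ae_of_all _ fun ω => abs_regressionKernelDeriv_apply_le a w hs x (ε ω) h)).trans_eq ?_
  rw [integral_const_mul, integral_add (integrable_const _) (hint.const_mul _),
    integral_const_mul, integral_const, probReal_univ, one_smul]

lemma sq_abs_fderiv_integral_regressionKernel_le (hs : 0 < s) (hm : ContDiff ℝ 1 m)
    (hA : ContDiff ℝ 1 A) (hε : Measurable ε) (hint : Integrable (fun ω => ‖ε ω‖) μ) (x : E)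
    {h : E} (hh : ‖h‖ = 1) :
    |fderiv ℝ (fun y => ∫ ω, regressionKernel s m A a w y (ε ω) ∂μ) x h| ^ 2 ≤
      3 * (s⁻¹ + 1) ^ 2 * (1 + (∫ ω, ‖ε ω‖ ∂μ) ^ 2) *
        (1 + (‖fderiv ℝ m x h‖ ^ 2 + ‖fderiv ℝ A x h‖ ^ 2)) := by
  have hle := abs_fderiv_integral_regressionKernel_le a w hs hm hA hε hint x h
  rw [hh] at hle
  set p := ‖fderiv ℝ m x h‖
  set q := ‖fderiv ℝ A x h‖
  set M := ∫ ω, ‖ε ω‖ ∂μ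
  calc _ ≤ ((s⁻¹ + 1) * (1 + p + q * M)) ^ 2 := pow_le_pow_left₀ (abs_nonneg _) hle 2
    _ = (s⁻¹ + 1) ^ 2 * (1 + p + q * M) ^ 2 := by ring
    _ ≤ (s⁻¹ + 1) ^ 2 * (3 * ((1 + M ^ 2) * (1 + (p ^ 2 + q ^ 2)))) := by
        gcongr
        nlinarith [sq_nonneg (1 - p), sq_nonneg (1 - q * M), sq_nonneg (p - q * M),
          sq_nonneg (M * p), sq_nonneg M, sq_nonneg q]
    _ = _ := by ring

end RegressionKernel

/-- A pointwise affine bound passes to the integral of suprema over translates. -/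
lemma lintegral_iSup_ite_lt_top {E Ω : Type*} [NormedAddCommGroup E] [ProperSpace E]
    [MeasurableSpace Ω] {μ : Measure Ω} [IsFiniteMeasure μ] (X : Ω → E) (T : Set E) {r : ℝ}
    (hr : 0 ≤ r) {f : E → ℝ} (hf : Continuous f) (hf₀ : ∀ x, 0 ≤ f x) {g : Ω → E → ℝ} {K : ℝ}
    (hK : 0 ≤ K) (hg : ∀ ω x, g ω x ≤ K * (1 + f x))
    (hfin : ∫⁻ ω, ENNReal.ofReal (⨆ x₀ : closedBall (0 : E) r,
      if X ω + (x₀ : E) ∈ T then f (X ω + (x₀ : E)) else 0) ∂μ < ⊤) :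
    ∫⁻ ω, ENNReal.ofReal (⨆ x₀ : closedBall (0 : E) r,
      if X ω + (x₀ : E) ∈ T then g ω (X ω + (x₀ : E)) else 0) ∂μ < ⊤ := by
  have : Nonempty (closedBall (0 : E) r) := ⟨⟨0, mem_closedBall_self hr⟩⟩
  have hsup (ω : Ω) : (⨆ x₀ : closedBall (0 : E) r,
      if X ω + (x₀ : E) ∈ T then g ω (X ω + (x₀ : E)) else 0) ≤
      K + K * ⨆ x₀ : closedBall (0 : E) r,
        if X ω + (x₀ : E) ∈ T then f (X ω + (x₀ : E)) else 0 := by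
    have hbdd : BddAbove (range fun x₀ : closedBall (0 : E) r =>
        if X ω + (x₀ : E) ∈ T then f (X ω + (x₀ : E)) else 0) := by
      obtain ⟨B, hB⟩ := (isCompact_closedBall (0 : E) r).bddAbove_image
        (hf.comp (continuous_const_add (X ω))).continuousOn
      refine ⟨B, ?_⟩
      rintro _ ⟨x₀, rfl⟩
      have hx₀ : f (X ω + (x₀ : E)) ≤ B := hB (mem_image_of_mem _ x₀.2)
      dsimp only
      split_ifs
      · exact hx₀
      · exact (hf₀ _).trans hx₀
    refine ciSup_le fun x₀ => ?_
    refine le_trans ?_ (add_le_add_right (mul_le_mul_of_nonneg_left (le_ciSup hbdd x₀) hK) K)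
    split_ifs
    · linarith [hg ω (X ω + (x₀ : E))]
    · simpa using hK
  calc _ ≤ ∫⁻ ω, (ENNReal.ofReal K + ENNReal.ofReal K *
        ENNReal.ofReal (⨆ x₀ : closedBall (0 : E) r,
          if X ω + (x₀ : E) ∈ T then f (X ω + (x₀ : E)) else 0)) ∂μ := by
        refine lintegral_mono fun ω => ?_
        rw [← ENNReal.ofReal_mul hK]
        exact (ENNReal.ofReal_le_ofReal (hsup ω)).trans ENNReal.ofReal_add_le
    _ < ⊤ := by
        rw [lintegral_add_left measurable_const, lintegral_const,
          lintegral_const_mul' _ _ ENNReal.ofReal_ne_top]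
        exact ENNReal.add_lt_top.2 ⟨ENNReal.mul_lt_top ENNReal.ofReal_lt_top (measure_lt_top _ _),
          ENNReal.mul_lt_top ENNReal.ofReal_lt_top hfin⟩

theorem proposition1
    {d : ℕ} (hd : 0 < d)
    {Ω : Type*} [MeasureSpace Ω] [IsProbabilityMeasure (ℙ : Measure Ω)]
    {𝒲 : Type*} [NormedAddCommGroup 𝒲] [InnerProductSpace ℝ 𝒲] [CompleteSpace 𝒲]
    [MeasurableSpace 𝒲] [BorelSpace 𝒲] [SecondCountableTopology 𝒲]
    {𝒮 : Type*} [NormedAddCommGroup 𝒮] [NormedSpace ℝ 𝒮]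
    [MeasurableSpace 𝒮] [BorelSpace 𝒮]
    (σc2 : ℝ) (hσ : 0 < σc2)
    (X : Ω → EuclideanSpace ℝ (Fin d)) (EW : Ω → 𝒮)
    (mW : EuclideanSpace ℝ (Fin d) → 𝒲)
    (SigW : EuclideanSpace ℝ (Fin d) → (𝒮 →L[ℝ] 𝒲))
    (hX : Measurable X) (hEW : Measurable EW)
    -- 𝓔_W is independent of X and E‖𝓔_W‖ < ∞
    (hindep : IndepFun X EW ℙ)
    (hmom : Integrable (fun ω => ‖EW ω‖) ℙ)
    -- m_W and Σ_W continuously Fréchet differentiable (Σ_W w.r.t. the operator norm)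
    (hmW : ContDiff ℝ 1 mW) (hSigW : ContDiff ℝ 1 SigW)
    -- the Gaussian kernel on 𝒵 = ℝ^d × 𝒲
    (c : (EuclideanSpace ℝ (Fin d) × 𝒲) → (EuclideanSpace ℝ (Fin d) × 𝒲) → ℝ)
    (hc : ∀ z z', c z z' = Real.exp (-(‖z.1 - z'.1‖ ^ 2 + ‖z.2 - z'.2‖ ^ 2) / σc2))
    -- the regression model W = m_W(X) + Σ_W(X)(𝓔_W), Z = (X, W)
    (W : Ω → 𝒲) (hW : ∀ ω, W ω = mW (X ω) + SigW (X ω) (EW ω))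
    -- b(x,z') = E[c(Z,z')|X=x], computed via independence
    (b : EuclideanSpace ℝ (Fin d) → (EuclideanSpace ℝ (Fin d) × 𝒲) → ℝ)
    (hb : ∀ x z', b x z' = ∫ ω, c (x, mW x + SigW x (EW ω)) z' ∂(ℙ : Measure Ω))
    -- the support of P_X
    (supp : Set (EuclideanSpace ℝ (Fin d)))
    (hsupp : supp = {x | ∀ U : Set (EuclideanSpace ℝ (Fin d)),
      IsOpen U → x ∈ U → (ℙ : Measure Ω).map X U ≠ 0})
    -- hypothesis (Pr1.2)
    (h₂ : ℝ) (hh₂ : 0 < h₂)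
    (hPr12 : ∑ k : Fin d,
      (∫⁻ ω, ENNReal.ofReal (⨆ x₀ : (closedBall (0 : EuclideanSpace ℝ (Fin d)) h₂),
          if X ω + (x₀ : EuclideanSpace ℝ (Fin d)) ∈ supp then
            ‖fderiv ℝ mW (X ω + (x₀ : EuclideanSpace ℝ (Fin d)))
                (EuclideanSpace.single k 1)‖ ^ 2
              + ‖fderiv ℝ SigW (X ω + (x₀ : EuclideanSpace ℝ (Fin d)))
                (EuclideanSpace.single k 1)‖ ^ 2
          else 0) ∂(ℙ : Measure Ω)) < ⊤) :
    -- conclusion: condition (T3)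
    (∀ z', ContDiff ℝ 1 (fun x => b x z')) ∧
      ∑ k : Fin d,
        (∫⁻ ω, ENNReal.ofReal (⨆ x₀ : (closedBall (0 : EuclideanSpace ℝ (Fin d)) h₂),
            if X ω + (x₀ : EuclideanSpace ℝ (Fin d)) ∈ supp then
              |fderiv ℝ (fun x => b x (X ω, W ω)) (X ω + (x₀ : EuclideanSpace ℝ (Fin d)))
                (EuclideanSpace.single k 1)| ^ 2
            else 0) ∂(ℙ : Measure Ω)) < ⊤ := by
  have hbK (z' : EuclideanSpace ℝ (Fin d) × 𝒲) : (fun x => b x z') =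
      fun x => ∫ ω, regressionKernel σc2 mW SigW z'.1 z'.2 x (EW ω) ∂(ℙ : Measure Ω) := by
    funext x
    simp only [hb, hc, regressionKernel, gaussianBump, ← Real.exp_add, neg_add, add_div]
  refine ⟨fun z' => ?_, ENNReal.sum_lt_top.2 fun k hk => ?_⟩
  · rw [hbK]
    exact contDiff_integral_regressionKernel _ _ hσ hmW hSigW hEW hmom
  · have hm' := hmW.continuous_fderiv one_ne_zero
    have hA' := hSigW.continuous_fderiv one_ne_zero
    refine lintegral_iSup_ite_lt_top X supp hh₂.le
      (f := fun x => ‖fderiv ℝ mW x (EuclideanSpace.single k 1)‖ ^ 2 +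
        ‖fderiv ℝ SigW x (EuclideanSpace.single k 1)‖ ^ 2)
      (by fun_prop) (fun x => by positivity)
      (g := fun ω x => |fderiv ℝ (fun x => b x (X ω, W ω)) x (EuclideanSpace.single k 1)| ^ 2)
      (K := 3 * (σc2⁻¹ + 1) ^ 2 * (1 + (∫ ω, ‖EW ω‖ ∂(ℙ : Measure Ω)) ^ 2))
      (by positivity) (fun ω x => ?_) (ENNReal.sum_lt_top.1 hPr12 k hk)
    rw [hbK]
    exact sq_abs_fderiv_integral_regressionKernel_le _ _ hσ hmW hSigW hEW hmom x (by simp)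

end
end

section
/- Lemma 1-(5): Under conditions (T2) and (T4), for i.i.d. X_i, X_k with density f and a product kernel K of order ν supported on [−1,1]^d with bandwidth h → 0, E[K_h(X_i−X_k)|X_i] = f(X_i) + O_{L⁴}(h^ν), i.e. E[ |E[K_h(X_i−X_k)|X_i] − f(X_i)|⁴ ] = O(h^{4ν}). -/
/-!
Lemma 1-(5): under conditions (T2) and (T4), for i.i.d. `X_i, X_k` with density `f` and a
product kernel `K` of order `ν` supported on `[-1,1]^d` with bandwidth `h → 0`,
`E[K_h(X_i−X_k) | X_i] = f(X_i) + O_{L⁴}(h^ν)`, i.e.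
`E[ |E[K_h(X_i−X_k)|X_i] − f(X_i)|⁴ ] = O(h^{4ν})`; the conditional expectation given
`X_i` is computed, via independence, as the integral over the law of `X_k`.
-/

open MeasureTheory ProbabilityTheory Filter Set Metric
open scoped ENNReal Classical

noncomputable section

abbrev Ed5 (d : ℕ) := EuclideanSpace ℝ (Fin d)

theorem ContinuousMultilinearMap.apply_const_eq_sum_single {d n : ℕ}
    (M : ContinuousMultilinearMap ℝ (fun _ : Fin n => Ed5 d) ℝ) (u : Ed5 d) :
    M (fun _ => u) = ∑ k : Fin n → Fin d,
      (∏ j, u (k j)) * M (fun j => EuclideanSpace.single (k j) 1) := by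
  have hu : u = ∑ l, u l • EuclideanSpace.single l (1 : ℝ) := by
    ext i
    simp [Finset.sum_apply, Pi.single_apply]
  conv_lhs => rw [hu]
  rw [M.map_sum (fun (_ : Fin n) (l : Fin d) => u l • EuclideanSpace.single l (1 : ℝ))]
  refine Finset.sum_congr rfl fun k _ => ?_
  rw [M.map_smul_univ (fun j => u (k j)) (fun j => EuclideanSpace.single (k j) 1), smul_eq_mul]

theorem abs_taylor_remainder_le {d n : ℕ} {f : Ed5 d → ℝ} (hf : ContDiff ℝ (n + 1) f)
    (x y : Ed5 d) {r : ℝ} (hy : ∀ l, |y l| ≤ r) (B : (Fin (n + 1) → Fin d) → ℝ)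
    (hB : ∀ k, ∀ t ∈ Icc (0 : ℝ) 1, |iteratedFDeriv ℝ (n + 1) f (x + t • y)
      (fun l => EuclideanSpace.single (k l) 1)| ≤ B k) :
    |f (x + y) - ∑ i ∈ Finset.range (n + 1), (i.factorial : ℝ)⁻¹ *
      iteratedFDeriv ℝ i f x (fun _ => y)| ≤ r ^ (n + 1) * ∑ k, B k := by
  have hT := map_add_eq_sum_add_integral_iteratedFDeriv (f := f) (x := x) (y := y) (n := n)
    fun t _ => hf.contDiffAt
  simp only [smul_eq_mul] at hT
  rw [hT, add_sub_cancel_left, abs_mul]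
  have hpt : ∀ t ∈ Icc (0 : ℝ) 1,
      |iteratedFDeriv ℝ (n + 1) f (x + t • y) (fun _ => y)| ≤ r ^ (n + 1) * ∑ k, B k := by
    intro t ht
    rw [ContinuousMultilinearMap.apply_const_eq_sum_single, Finset.mul_sum]
    refine (Finset.abs_sum_le_sum_abs _ _).trans (Finset.sum_le_sum fun k _ => ?_)
    rw [abs_mul, Finset.abs_prod]
    have h1 : ∏ j, |y (k j)| ≤ r ^ (n + 1) := by
      simpa using Finset.prod_le_prod (s := Finset.univ) (fun j _ => abs_nonneg (y (k j)))
        (fun j _ => hy (k j))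
    exact mul_le_mul h1 (hB k t ht) (abs_nonneg _)
      ((Finset.prod_nonneg fun j _ => abs_nonneg _).trans h1)
  have hnn : 0 ≤ r ^ (n + 1) * ∑ k, B k := (abs_nonneg _).trans (hpt 0 (by simp))
  have hint : |∫ t in (0 : ℝ)..1, (1 - t) ^ n *
      iteratedFDeriv ℝ (n + 1) f (x + t • y) (fun _ => y)| ≤ r ^ (n + 1) * ∑ k, B k := by
    have := intervalIntegral.norm_integral_le_of_norm_le_const (a := (0 : ℝ)) (b := 1)
      (C := r ^ (n + 1) * ∑ k, B k) (f := fun t => (1 - t) ^ n *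
      iteratedFDeriv ℝ (n + 1) f (x + t • y) (fun _ => y)) (by
        intro t ht
        rw [uIoc_of_le zero_le_one] at ht
        rw [norm_mul, Real.norm_eq_abs, Real.norm_eq_abs]
        refine (mul_le_of_le_one_left (abs_nonneg _) ?_).trans (hpt t ⟨ht.1.le, ht.2⟩)
        rw [abs_of_nonneg (pow_nonneg (by linarith [ht.2]) _)]
        exact pow_le_one₀ (by linarith [ht.2]) (by linarith [ht.1]))
    simpa using this
  refine (mul_le_of_le_one_left (abs_nonneg _) ?_).trans hint
  rw [abs_of_nonneg (by positivity)]
  exact inv_le_one_of_one_le₀ (by exact_mod_cast n.factorial_pos)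

theorem integral_prod_mul_prod_comp {d n : ℕ} (Ku : ℝ → ℝ) (k : Fin n → Fin d) :
    (∫ u : Ed5 d, (∏ l, Ku (u l)) * ∏ j, u (k j))
      = ∏ l, ∫ t, Ku t * t ^ (Finset.univ.filter fun j => k j = l).card := by
  rw [← integral_fintype_prod_volume_eq_prod
    (f := fun l t => Ku t * t ^ (Finset.univ.filter fun j => k j = l).card),
    ← (PiLp.volume_preserving_ofLp (Fin d)).integral_comp
      (MeasurableEquiv.toLp 2 (Fin d → ℝ)).symm.measurableEmbedding]
  refine integral_congr_ae (ae_of_all _ fun u => ?_)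
  simp only [Finset.prod_mul_distrib]
  congr 1
  rw [← Finset.prod_fiberwise (s := Finset.univ) (g := k)]
  refine Finset.prod_congr rfl fun l _ => ?_
  rw [Finset.prod_congr rfl (g := fun _ => u l), Finset.prod_const]
  intro j hj
  rw [(Finset.mem_filter.1 hj).2]

theorem integral_prod_mul_prod_comp_eq_zero {d ν n : ℕ} {Ku : ℝ → ℝ}
    (hKord : ∀ i < ν, (∫ t, Ku t * t ^ i) = if i = 0 then (1:ℝ) else 0)
    (k : Fin n → Fin d) (j₀ : Fin n)
    (hlt : (Finset.univ.filter fun j => k j = k j₀).card < ν) :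
    (∫ u : Ed5 d, (∏ l, Ku (u l)) * ∏ j, u (k j)) = 0 := by
  rw [integral_prod_mul_prod_comp]
  refine Finset.prod_eq_zero (Finset.mem_univ (k j₀)) ?_
  rw [hKord _ hlt, if_neg]
  exact (Finset.card_pos.2 ⟨j₀, by simp⟩).ne'

theorem integral_prod_eq_one {d ν : ℕ} (hν : 0 < ν) {Ku : ℝ → ℝ}
    (hKord : ∀ i < ν, (∫ t, Ku t * t ^ i) = if i = 0 then (1:ℝ) else 0) :
    (∫ u : Ed5 d, ∏ l, Ku (u l)) = 1 := by
  have h0 := hKord 0 hν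
  simp only [pow_zero, mul_one, if_true] at h0
  simpa [h0] using integral_prod_mul_prod_comp (d := d) (n := 0) Ku Fin.elim0

theorem prod_eq_zero_of_one_lt {d : ℕ} {Ku : ℝ → ℝ} (hKsupp : ∀ t : ℝ, 1 < |t| → Ku t = 0)
    {u : Ed5 d} (hu : ∏ l, Ku (u l) ≠ 0) (l : Fin d) : |u l| ≤ 1 := by
  by_contra! hlt
  exact hu (Finset.prod_eq_zero (Finset.mem_univ l) (hKsupp _ hlt))

theorem norm_le_sqrt_of_abs_le_one {d : ℕ} {u : Ed5 d} (hu : ∀ l, |u l| ≤ 1) :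
    ‖u‖ ≤ √d := by
  rw [EuclideanSpace.norm_eq]
  refine Real.sqrt_le_sqrt ?_
  calc ∑ l, ‖u l‖ ^ 2 ≤ ∑ _l : Fin d, (1 : ℝ) :=
        Finset.sum_le_sum fun l _ => pow_le_one₀ (norm_nonneg _) (hu l)
    _ = d := by simp

theorem integrable_prod_mul_continuous {d : ℕ} {Ku : ℝ → ℝ} (hKu : Measurable Ku)
    (hKbdd : ∃ C, ∀ t, |Ku t| ≤ C) (hKsupp : ∀ t : ℝ, 1 < |t| → Ku t = 0)
    {g : Ed5 d → ℝ} (hg : Continuous g) :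
    Integrable (fun u : Ed5 d => (∏ l, Ku (u l)) * g u) := by
  obtain ⟨C, hC⟩ := hKbdd
  have hsub : Function.support (fun u : Ed5 d => (∏ l, Ku (u l)) * g u)
      ⊆ closedBall 0 √d := by
    intro u hu
    have hK : ∏ l, Ku (u l) ≠ 0 := left_ne_zero_of_mul hu
    simpa using norm_le_sqrt_of_abs_le_one (prod_eq_zero_of_one_lt hKsupp hK)
  rw [← integrableOn_iff_integrable_of_support_subset hsub]
  refine Integrable.bdd_mul (c := C ^ d)
    (hg.continuousOn.integrableOn_compact (isCompact_closedBall _ _)) ?_ ?_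
  · exact (Finset.measurable_prod _ fun l _ => hKu.comp (by fun_prop)).aestronglyMeasurable
  · refine ae_of_all _ fun u => ?_
    rw [Real.norm_eq_abs, Finset.abs_prod]
    simpa using Finset.prod_le_prod (s := Finset.univ) (fun j _ => abs_nonneg (Ku (u j)))
      (fun j _ => hC (u j))

theorem integral_prod_mul_multilinear {d n : ℕ} {Ku : ℝ → ℝ} (hKu : Measurable Ku)
    (hKbdd : ∃ C, ∀ t, |Ku t| ≤ C) (hKsupp : ∀ t : ℝ, 1 < |t| → Ku t = 0)
    (M : ContinuousMultilinearMap ℝ (fun _ : Fin n => Ed5 d) ℝ) :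
    (∫ u : Ed5 d, (∏ l, Ku (u l)) * M (fun _ => u)) = ∑ k : Fin n → Fin d,
      (∫ u : Ed5 d, (∏ l, Ku (u l)) * ∏ j, u (k j)) *
        M (fun j => EuclideanSpace.single (k j) 1) := by
  simp_rw [← integral_mul_const]
  rw [← integral_finsetSum]
  · refine integral_congr_ae (ae_of_all _ fun u => ?_)
    simp only [M.apply_const_eq_sum_single u, Finset.mul_sum, mul_assoc]
  · intro k _
    exact (integrable_prod_mul_continuous hKu hKbdd hKsupp (by fun_prop)).mul_const _

theorem integral_prod_mul_multilinear_eq_zero {d ν n : ℕ} {Ku : ℝ → ℝ} (hKu : Measurable Ku)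
    (hKbdd : ∃ C, ∀ t, |Ku t| ≤ C) (hKsupp : ∀ t : ℝ, 1 < |t| → Ku t = 0)
    (hKord : ∀ i < ν, (∫ t, Ku t * t ^ i) = if i = 0 then (1:ℝ) else 0)
    (hn : 0 < n) (hnν : n < ν)
    (M : ContinuousMultilinearMap ℝ (fun _ : Fin n => Ed5 d) ℝ) :
    (∫ u : Ed5 d, (∏ l, Ku (u l)) * M (fun _ => u)) = 0 := by
  rw [integral_prod_mul_multilinear hKu hKbdd hKsupp]
  refine Finset.sum_eq_zero fun k _ => ?_
  rw [integral_prod_mul_prod_comp_eq_zero hKord k ⟨0, hn⟩, zero_mul]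
  refine (Finset.card_filter_le _ _).trans_lt ?_
  simpa using hnν

theorem abs_integral_prod_mul_multilinear_le {d ν : ℕ} {Ku : ℝ → ℝ} (hν : 0 < ν)
    (hKu : Measurable Ku)
    (hKbdd : ∃ C, ∀ t, |Ku t| ≤ C) (hKsupp : ∀ t : ℝ, 1 < |t| → Ku t = 0)
    (hKord : ∀ i < ν, (∫ t, Ku t * t ^ i) = if i = 0 then (1:ℝ) else 0)
    (M : ContinuousMultilinearMap ℝ (fun _ : Fin ν => Ed5 d) ℝ) :
    |∫ u : Ed5 d, (∏ l, Ku (u l)) * M (fun _ => u)| ≤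
      d ^ ν * ((∫ u : Ed5 d, |∏ l, Ku (u l)|) *
        ∑ l, |M (fun _ => EuclideanSpace.single l 1)|) := by
  have hA : 0 ≤ ∫ u : Ed5 d, |∏ l, Ku (u l)| := integral_nonneg fun u => abs_nonneg _
  rw [integral_prod_mul_multilinear hKu hKbdd hKsupp]
  refine (Finset.abs_sum_le_sum_abs _ _).trans ?_
  refine (Finset.sum_le_card_nsmul Finset.univ _ ((∫ u : Ed5 d, |∏ l, Ku (u l)|) *
        ∑ l, |M (fun _ => EuclideanSpace.single l 1)|) fun k _ => ?_).trans_eq (by simp)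
  by_cases hk : ∃ j, k j ≠ k ⟨0, hν⟩
  · obtain ⟨j, hj⟩ := hk
    rw [integral_prod_mul_prod_comp_eq_zero hKord k ⟨0, hν⟩]
    · simp only [zero_mul, abs_zero]
      positivity
    · have := Finset.card_lt_card (s := Finset.univ.filter fun j => k j = k ⟨0, hν⟩)
        (t := Finset.univ) (Finset.filter_ssubset.2 ⟨j, Finset.mem_univ _, hj⟩)
      simpa using this
  · push Not at hk
    rw [abs_mul]
    have hM : M (fun j => EuclideanSpace.single (k j) 1)
        = M (fun _ => EuclideanSpace.single (k ⟨0, hν⟩) 1) := by simp only [hk]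
    rw [hM]
    refine mul_le_mul ?_ (Finset.single_le_sum
      (f := fun l => |M (fun _ => EuclideanSpace.single l 1)|)
      (fun l _ => abs_nonneg _) (Finset.mem_univ _)) (abs_nonneg _) hA
    refine abs_integral_le_integral_abs.trans (integral_mono_of_nonneg
      (ae_of_all _ fun u => abs_nonneg _) ?_ (ae_of_all _ fun u => ?_))
    · simpa using (integrable_prod_mul_continuous hKu hKbdd hKsupp
        (continuous_const (y := (1 : ℝ)))).abs
    · by_cases h0 : ∏ l, Ku (u l) = 0
      · simp [h0]
      · simp only [abs_mul]
        refine mul_le_of_le_one_right (abs_nonneg _) ?_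
        rw [Finset.abs_prod]
        exact Finset.prod_le_one (fun j _ => abs_nonneg _)
          fun j _ => prod_eq_zero_of_one_lt hKsupp h0 _

theorem abs_integral_prod_mul_comp_sub_le {d ν : ℕ} {Ku : ℝ → ℝ} (hν : 0 < ν)
    (hKu : Measurable Ku)
    (hKbdd : ∃ C, ∀ t, |Ku t| ≤ C) (hKsupp : ∀ t : ℝ, 1 < |t| → Ku t = 0)
    (hKord : ∀ i < ν, (∫ t, Ku t * t ^ i) = if i = 0 then (1:ℝ) else 0)
    {f : Ed5 d → ℝ} (hf : ContDiff ℝ (ν + 1) f) {h : ℝ} (h0 : 0 < h) (h1 : h ≤ 1) (x : Ed5 d)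
    (B : (Fin (ν + 1) → Fin d) → ℝ)
    (hB : ∀ k, ∀ z ∈ closedBall (0 : Ed5 d) (√d * h), |iteratedFDeriv ℝ (ν + 1) f (x + z)
      (fun l => EuclideanSpace.single (k l) 1)| ≤ B k) :
    |(∫ u : Ed5 d, (∏ l, Ku (u l)) * f (x - h • u)) - f x| ≤
      (d ^ ν + 1) * (∫ u : Ed5 d, |∏ l, Ku (u l)|) * h ^ ν *
        ((∑ l, |iteratedFDeriv ℝ ν f x (fun _ => EuclideanSpace.single l 1)|) + ∑ k, B k) := by
  set A := ∫ u : Ed5 d, |∏ l, Ku (u l)| with hAdef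
  have hA : 0 ≤ A := integral_nonneg fun u => abs_nonneg _
  set D := ∑ l, |iteratedFDeriv ℝ ν f x (fun _ => EuclideanSpace.single l 1)|
  have hD0 : 0 ≤ D := Finset.sum_nonneg fun l _ => abs_nonneg _
  have hB0 : 0 ≤ ∑ k, B k := Finset.sum_nonneg fun k _ =>
    (abs_nonneg _).trans (hB k 0 (by simp; positivity))
  have hKint : Integrable (fun u : Ed5 d => |∏ l, Ku (u l)|) := by
    simpa using (integrable_prod_mul_continuous hKu hKbdd hKsupp
      (continuous_const (y := (1 : ℝ)))).abs
  set P : Ed5 d → ℝ := fun u => ∑ i ∈ Finset.range (ν + 1), (i.factorial : ℝ)⁻¹ * (-h) ^ i *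
    iteratedFDeriv ℝ i f x (fun _ => u) with hP
  have hTc : ∀ i, Continuous fun u : Ed5 d => iteratedFDeriv ℝ i f x (fun _ => u) :=
    fun i => (iteratedFDeriv ℝ i f x).cont.comp (continuous_pi fun _ => continuous_id)
  have hPc : Continuous P := continuous_finsetSum _ fun i _ => continuous_const.mul (hTc i)
  have hfc : Continuous fun u : Ed5 d => f (x - h • u) := hf.continuous.comp (by fun_prop)
  have hPint : (∫ u : Ed5 d, (∏ l, Ku (u l)) * P u) = f x + (ν.factorial : ℝ)⁻¹ * (-h) ^ ν *
      ∫ u : Ed5 d, (∏ l, Ku (u l)) * iteratedFDeriv ℝ ν f x (fun _ => u) := by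
    have hsum : (∫ u : Ed5 d, (∏ l, Ku (u l)) * P u) = ∑ i ∈ Finset.range (ν + 1),
        (i.factorial : ℝ)⁻¹ * (-h) ^ i *
          ∫ u : Ed5 d, (∏ l, Ku (u l)) * iteratedFDeriv ℝ i f x (fun _ => u) := by
      simp_rw [← integral_const_mul]
      rw [← integral_finsetSum]
      · refine integral_congr_ae (ae_of_all _ fun u => ?_)
        simp only [hP, Finset.mul_sum]
        exact Finset.sum_congr rfl fun i _ => by ring
      · exact fun i _ => (integrable_prod_mul_continuous hKu hKbdd hKsupp (hTc i)).const_mul _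
    rw [hsum, Finset.sum_range_succ, Finset.sum_eq_single 0]
    · simp [integral_mul_const, integral_prod_eq_one hν hKord]
    · intro i hi hi0
      rw [integral_prod_mul_multilinear_eq_zero hKu hKbdd hKsupp hKord (Nat.pos_of_ne_zero hi0)
        (Finset.mem_range.1 hi), mul_zero]
    · intro hn
      exact absurd (Finset.mem_range.2 hν) hn
  have hrem : |∫ u : Ed5 d, ((∏ l, Ku (u l)) * f (x - h • u) - (∏ l, Ku (u l)) * P u)|
      ≤ A * (h ^ (ν + 1) * ∑ k, B k) := by
    rw [hAdef, ← integral_mul_const]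
    refine abs_integral_le_integral_abs.trans (integral_mono_of_nonneg
      (ae_of_all _ fun u => abs_nonneg _) (hKint.mul_const _) (ae_of_all _ fun u => ?_))
    by_cases hK0 : ∏ l, Ku (u l) = 0
    · simp [hK0]
    · have hu := prod_eq_zero_of_one_lt hKsupp hK0
      simp only [← mul_sub, abs_mul]
      refine mul_le_mul_of_nonneg_left ?_ (abs_nonneg _)
      have hT := abs_taylor_remainder_le hf x ((-h) • u) (r := h) (fun l => by
        simpa [abs_mul, abs_of_pos h0] using mul_le_of_le_one_right h0.le (hu l)) B
        (fun k t ht => hB k _ (by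
          rw [mem_closedBall_zero_iff, norm_smul, norm_smul, norm_neg, Real.norm_of_nonneg h0.le,
            Real.norm_of_nonneg ht.1]
          refine (mul_le_of_le_one_left (by positivity) ht.2).trans ?_
          rw [mul_comm]
          exact mul_le_mul_of_nonneg_right (norm_le_sqrt_of_abs_le_one hu) h0.le))
      have hPu : P u = ∑ i ∈ Finset.range (ν + 1), (i.factorial : ℝ)⁻¹ *
          iteratedFDeriv ℝ i f x (fun _ => (-h) • u) := by
        refine Finset.sum_congr rfl fun i _ => ?_
        rw [(iteratedFDeriv ℝ i f x).map_smul_univ (fun _ => -h) (fun _ => u)]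
        simp [mul_assoc]
      rwa [← hPu, neg_smul, ← sub_eq_add_neg] at hT
  rw [integral_sub (integrable_prod_mul_continuous hKu hKbdd hKsupp hfc)
    (integrable_prod_mul_continuous hKu hKbdd hKsupp hPc), hPint] at hrem
  set J := ∫ u : Ed5 d, (∏ l, Ku (u l)) * iteratedFDeriv ℝ ν f x (fun _ => u)
  have hJle : |(ν.factorial : ℝ)⁻¹ * (-h) ^ ν * J| ≤ h ^ ν * (d ^ ν * (A * D)) := by
    rw [abs_mul, abs_mul, abs_pow, abs_neg, abs_of_pos h0,
      abs_of_nonneg (inv_nonneg.2 (Nat.cast_nonneg _))]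
    refine mul_le_mul (mul_le_of_le_one_left (by positivity)
      (inv_le_one_of_one_le₀ (by exact_mod_cast ν.factorial_pos)))
      (abs_integral_prod_mul_multilinear_le hν hKu hKbdd hKsupp hKord _) (abs_nonneg _)
      (by positivity)
  have hhν : h ^ (ν + 1) ≤ h ^ ν := pow_le_pow_of_le_one h0.le h1 (Nat.le_succ ν)
  have e1 : A * (h ^ (ν + 1) * ∑ k, B k) ≤ A * (h ^ ν * ∑ k, B k) := by gcongr
  have e2 : 0 ≤ A * (h ^ ν * D) := by positivity
  have e3 : 0 ≤ (d : ℝ) ^ ν * (A * (h ^ ν * ∑ k, B k)) := by positivity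
  calc |(∫ u : Ed5 d, (∏ l, Ku (u l)) * f (x - h • u)) - f x|
      ≤ A * (h ^ (ν + 1) * ∑ k, B k) + h ^ ν * (d ^ ν * (A * D)) := by
        refine le_trans ?_ (add_le_add hrem hJle)
        refine le_trans (le_of_eq ?_) (abs_add_le _ _)
        congr 1
        ring
    _ ≤ _ := by nlinarith

theorem integral_kernel_withDensity {d : ℕ} {f : Ed5 d → ℝ} (hfm : Measurable f)
    (hf0 : ∀ x, 0 ≤ f x) (K : Ed5 d → ℝ) {h : ℝ} (h0 : 0 < h) (x : Ed5 d) :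
    (∫ y, K (h⁻¹ • (x - y)) / h ^ d
        ∂(volume : Measure (Ed5 d)).withDensity fun y => ENNReal.ofReal (f y))
      = ∫ u, K u * f (x - h • u) := by
  rw [integral_withDensity_eq_integral_toReal_smul (by fun_prop) (by simp)]
  have hg := integral_sub_left_eq_self
    (fun z => (f (x - z)) * (K (h⁻¹ • z) / h ^ d)) (volume : Measure (Ed5 d)) x
  simp only [sub_sub_cancel] at hg
  simp only [smul_eq_mul, ENNReal.toReal_ofReal (hf0 _)]
  rw [hg]
  have hs := Measure.integral_comp_inv_smul_of_nonneg (volume : Measure (Ed5 d))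
    (fun u => K u * f (x - h • u)) h0.le
  simp only [smul_inv_smul₀ h0.ne', finrank_euclideanSpace, Fintype.card_fin, smul_eq_mul] at hs
  rw [← mul_right_inj' (pow_pos h0 d).ne', ← hs, ← integral_const_mul]
  refine integral_congr_ae (ae_of_all _ fun z => ?_)
  have := (pow_pos h0 d).ne'
  field_simp

theorem eventuallyEq_zero_of_withDensity_eq_zero {d : ℕ} {f : Ed5 d → ℝ} (hfc : Continuous f)
    (hf0 : ∀ x, 0 ≤ f x) {U : Set (Ed5 d)} (hU : IsOpen U)
    (hUf : (volume : Measure (Ed5 d)).withDensity (fun y => ENNReal.ofReal (f y)) U = 0)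
    {x : Ed5 d} (hx : x ∈ U) : f =ᶠ[nhds x] 0 := by
  rw [withDensity_apply _ hU.measurableSet, lintegral_eq_zero_iff (by fun_prop)] at hUf
  have hae : f =ᵐ[volume.restrict U] (fun _ => (0 : ℝ)) := by
    filter_upwards [hUf] with y hy
    exact le_antisymm (ENNReal.ofReal_eq_zero.1 hy) (hf0 y)
  have := Measure.eqOn_open_of_ae_eq hae hU hfc.continuousOn continuousOn_const
  filter_upwards [hU.mem_nhds hx] with y hy using this hy

theorem bddAbove_range_closedBall {E : Type*} [NormedAddCommGroup E] [ProperSpace E]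
    {g : E → ℝ} (hg : Continuous g) (r : ℝ) (x : E) :
    BddAbove (range fun z : closedBall (0 : E) r => g (x + z)) := by
  have : CompactSpace (closedBall (0 : E) r) :=
    isCompact_iff_compactSpace.1 (isCompact_closedBall _ _)
  exact (isCompact_range (by fun_prop)).bddAbove

theorem measurable_iSup_closedBall {E : Type*} [NormedAddCommGroup E] [ProperSpace E]
    [MeasurableSpace E] [BorelSpace E] {g : E → ℝ} (hg : Continuous g) (r : ℝ) :
    Measurable fun x : E => ⨆ z : closedBall (0 : E) r, g (x + z) :=
  (lowerSemicontinuous_ciSup (bddAbove_range_closedBall hg r) fun z =>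
    (by fun_prop : Continuous fun x => g (x + (z : E))).lowerSemicontinuous).measurable

theorem memLp_four_of_lintegral_pow_lt_top {Ω : Type*} [MeasurableSpace Ω] {μ : Measure Ω}
    {g : Ω → ℝ} (hg : Measurable g) (hg0 : ∀ ω, 0 ≤ g ω)
    (hfin : (∫⁻ ω, ENNReal.ofReal (g ω ^ 4) ∂μ) < ⊤) : MemLp g 4 μ := by
  refine ⟨hg.aestronglyMeasurable, ?_⟩
  rw [eLpNorm_lt_top_iff_lintegral_rpow_enorm_lt_top (by simp) (by simp)]
  convert hfin using 3 with ω
  rw [Real.enorm_of_nonneg (hg0 ω), ENNReal.ofReal_pow (hg0 ω)]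
  norm_num

theorem lemma1_5
    {d ν : ℕ} (hd : 0 < d) (hν : 0 < ν)
    {Ω : Type*} [MeasureSpace Ω] [IsProbabilityMeasure (ℙ : Measure Ω)]
    (X₁ X₂ : Ω → Ed5 d) (f : Ed5 d → ℝ) (Ku : ℝ → ℝ) (h : ℕ → ℝ)
    (hh : ∀ n, 0 < h n) (hlim : Tendsto h atTop (nhds 0))
    (hX₁ : Measurable X₁) (hX₂ : Measurable X₂) (hfm : Measurable f) (hKu : Measurable Ku)
    (hindep : IndepFun X₁ X₂ ℙ) (hident : IdentDistrib X₁ X₂ ℙ ℙ)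
    (hf0 : ∀ x, 0 ≤ f x)
    (hdens : (ℙ : Measure Ω).map X₁
      = (volume : Measure (Ed5 d)).withDensity fun x => ENNReal.ofReal (f x))
    -- (A1): bounded symmetric product kernel of order ν supported on [-1,1]^d
    (hKbdd : ∃ C, ∀ t, |Ku t| ≤ C)
    (hKsymm : ∀ t, Ku (-t) = Ku t)
    (hKsupp : ∀ t : ℝ, 1 < |t| → Ku t = 0)
    (hKord : ∀ i < ν, (∫ t, Ku t * t ^ i) = if i = 0 then (1:ℝ) else 0) :
    -- (T2) (for f): ν+1 times continuously differentiable with fourth-moment bounds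
    ContDiff ℝ (ν + 1) f →
    (∃ h₁ > (0:ℝ), ∀ k : Fin (ν + 1) → Fin d,
      (∫⁻ ω, ENNReal.ofReal ((⨆ x₀ : (closedBall (0 : Ed5 d) h₁),
          if X₁ ω + (x₀ : Ed5 d) ∈
              {x | ∀ U : Set (Ed5 d), IsOpen U → x ∈ U → (ℙ : Measure Ω).map X₁ U ≠ 0} then
            |iteratedFDeriv ℝ (ν + 1) f (X₁ ω + (x₀ : Ed5 d))
              (fun l => EuclideanSpace.single (k l) 1)| else 0) ^ 4) ∂(ℙ : Measure Ω)) < ⊤) →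
    (∀ k : Fin d,
      (∫⁻ ω, ENNReal.ofReal
          (|iteratedFDeriv ℝ ν f (X₁ ω) (fun _ => EuclideanSpace.single k 1)| ^ 4)
        ∂(ℙ : Measure Ω)) < ⊤) →
    -- (T4): negligibility of the boundary region of supp(P_X)
    (∃ C, ∀ᶠ n in atTop,
      (∫⁻ ω, ENNReal.ofReal ((⨆ x₀ : (closedBall (0 : Ed5 d) (Real.sqrt d * h n)),
          if infDist (X₁ ω)
              (frontier {x | ∀ U : Set (Ed5 d), IsOpen U → x ∈ U → (ℙ : Measure Ω).map X₁ U ≠ 0})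
              ≤ Real.sqrt d * h n then
            |f (X₁ ω + (x₀ : Ed5 d))| else 0) ^ 4) ∂(ℙ : Measure Ω))
        ≤ ENNReal.ofReal (C * h n ^ (4 * ν))) →
    -- conclusion: E[K_h(X_i−X_k)|X_i] = f(X_i) + O_{L⁴}(h^ν)
    ∃ C, ∀ᶠ n in atTop,
      (∫ ω, |(∫ ω', (∏ l, Ku (((h n)⁻¹ • (X₁ ω - X₂ ω')) l)) / h n ^ d ∂(ℙ : Measure Ω))
            - f (X₁ ω)| ^ 4 ∂(ℙ : Measure Ω))
        ≤ C * h n ^ (4 * ν) := by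
  rintro hf ⟨h₁, hh₁, hM⟩ hD -
  have hDc : ∀ k : Fin (ν + 1) → Fin d, Continuous fun x : Ed5 d =>
      |iteratedFDeriv ℝ (ν + 1) f x (fun l => EuclideanSpace.single (k l) 1)| := fun k =>
    ((ContinuousMultilinearMap.apply ℝ (fun _ : Fin (ν + 1) => Ed5 d) ℝ
      (fun l => EuclideanSpace.single (k l) 1)).continuous.comp
      (hf.continuous_iteratedFDeriv (by norm_cast))).abs
  have hEc : ∀ l : Fin d, Continuous fun x : Ed5 d =>
      |iteratedFDeriv ℝ ν f x (fun _ => EuclideanSpace.single l 1)| := fun l =>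
    ((ContinuousMultilinearMap.apply ℝ (fun _ : Fin ν => Ed5 d) ℝ
      (fun _ => EuclideanSpace.single l 1)).continuous.comp
      (hf.continuous_iteratedFDeriv (by norm_cast; omega))).abs
  have hoff : ∀ (k : Fin (ν + 1) → Fin d) (x : Ed5 d),
      (¬ ∀ U : Set (Ed5 d), IsOpen U → x ∈ U → (ℙ : Measure Ω).map X₁ U ≠ 0) →
      |iteratedFDeriv ℝ (ν + 1) f x (fun l => EuclideanSpace.single (k l) 1)| = 0 := by
    intro k x hx
    simp only [not_forall, not_not] at hx
    obtain ⟨U, hU, hxU, hU0⟩ := hx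
    rw [hdens] at hU0
    rw [((eventuallyEq_zero_of_withDensity_eq_zero hf.continuous hf0 hU hU0
      hxU).iteratedFDeriv ℝ (ν + 1)).self_of_nhds]
    simp
  set G₁ : Fin d → Ed5 d → ℝ := fun l x =>
    |iteratedFDeriv ℝ ν f x (fun _ => EuclideanSpace.single l 1)|
  set G₂ : (Fin (ν + 1) → Fin d) → Ed5 d → ℝ := fun k x => ⨆ z : closedBall (0 : Ed5 d) h₁,
    |iteratedFDeriv ℝ (ν + 1) f (x + z) (fun l => EuclideanSpace.single (k l) 1)|
  have hG₁L : ∀ l, MemLp (fun ω => G₁ l (X₁ ω)) 4 (ℙ : Measure Ω) := fun l =>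
    memLp_four_of_lintegral_pow_lt_top ((hEc l).measurable.comp hX₁)
      (fun ω => abs_nonneg _) (hD l)
  have hG₂L : ∀ k, MemLp (fun ω => G₂ k (X₁ ω)) 4 (ℙ : Measure Ω) := fun k =>
    memLp_four_of_lintegral_pow_lt_top ((measurable_iSup_closedBall (hDc k) h₁).comp hX₁)
      (fun ω => Real.iSup_nonneg fun z => abs_nonneg _) (by
        refine (lintegral_mono fun ω => le_of_eq ?_).trans_lt (hM k)
        refine congrArg (fun t : ℝ => ENNReal.ofReal (t ^ 4)) (iSup_congr fun z => ?_)
        split_ifs with hz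
        · rfl
        · exact hoff k _ hz)
  set G : Ω → ℝ := fun ω => (∑ l, G₁ l (X₁ ω)) + ∑ k, G₂ k (X₁ ω)
  have hGL : MemLp G 4 (ℙ : Measure Ω) :=
    (memLp_finsetSum _ fun l _ => hG₁L l).add (memLp_finsetSum _ fun k _ => hG₂L k)
  have hGint : Integrable (fun ω => G ω ^ 4) (ℙ : Measure Ω) := by
    have := hGL.integrable_norm_pow (p := 4) (by norm_num)
    refine this.congr (ae_of_all _ fun ω => ?_)
    simp only [Real.norm_eq_abs]
    exact Even.pow_abs (by decide) _
  set A : ℝ := (d ^ ν + 1) * ∫ u : Ed5 d, |∏ l, Ku (u l)|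
  refine ⟨A ^ 4 * ∫ ω, G ω ^ 4 ∂(ℙ : Measure Ω), ?_⟩
  have hlim' : Tendsto (fun n => √d * h n) atTop (nhds 0) := by
    simpa using hlim.const_mul √d
  filter_upwards [hlim.eventually (eventually_le_nhds zero_lt_one),
    hlim'.eventually (eventually_le_nhds hh₁)] with n hn1 hnh
  have hKm : Measurable fun u : Ed5 d => ∏ l, Ku (u l) :=
    Finset.measurable_prod _ fun l _ => hKu.comp (by fun_prop)
  have hconv : ∀ ω, (∫ ω', (∏ l, Ku (((h n)⁻¹ • (X₁ ω - X₂ ω')) l)) / h n ^ d ∂(ℙ : Measure Ω))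
      = ∫ u : Ed5 d, (∏ l, Ku (u l)) * f (X₁ ω - h n • u) := by
    intro ω
    rw [← integral_kernel_withDensity hfm hf0 (fun u => ∏ l, Ku (u l)) (hh n) (X₁ ω), ← hdens,
      hident.map_eq, integral_map hX₂.aemeasurable]
    exact ((hKm.comp (by fun_prop)).div_const _).aestronglyMeasurable
  have hpt : ∀ ω, |(∫ ω', (∏ l, Ku (((h n)⁻¹ • (X₁ ω - X₂ ω')) l)) / h n ^ d ∂(ℙ : Measure Ω))
      - f (X₁ ω)| ^ 4 ≤ (A ^ 4 * h n ^ (4 * ν)) * G ω ^ 4 := by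
    intro ω
    rw [hconv]
    have hb := abs_integral_prod_mul_comp_sub_le hν hKu hKbdd hKsupp hKord hf (hh n) hn1 (X₁ ω)
      (fun k => G₂ k (X₁ ω)) (fun k z hz => le_ciSup
        (bddAbove_range_closedBall (hDc k) h₁ (X₁ ω))
        (⟨z, closedBall_subset_closedBall hnh hz⟩ : closedBall (0 : Ed5 d) h₁))
    calc _ ≤ (A * h n ^ ν * G ω) ^ 4 := pow_le_pow_left₀ (abs_nonneg _) hb 4
      _ = _ := by ring
  calc _ ≤ ∫ ω, (A ^ 4 * h n ^ (4 * ν)) * G ω ^ 4 ∂(ℙ : Measure Ω) :=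
        integral_mono_of_nonneg (ae_of_all _ fun ω => by positivity)
          (hGint.const_mul _) (ae_of_all _ hpt)
    _ = _ := by
        rw [integral_const_mul]
        ring

end
end
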